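/- arXiv:0708.1980 — 2 statements merged into one kernel-verified Lean document; each statement's English description precedes it below -/
import Mathlib

section
/- If κ is a limit cardinal and G is a κ-free abelian group of cardinality κ, then G is strongly κ-free. -/
universe u

/-- An abelian group is free if it is a free `ℤ`-module. -/
def IsFreeAbelian (G : Type u) [AddCommGroup G] : Prop :=
  Module.Free ℤ G

/-- `G` is `κ`-free: every subgroup of cardinality `< κ` is free. -/
def IsKappaFree (κ : Cardinal.{u}) (G : Type u) [AddCommGroup G] : Prop :=
  ∀ H : AddSubgroup G, Cardinal.mk H < κ → IsFreeAbelian H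

/-- `G` is a Whitehead group. -/
def IsWhitehead (G : Type u) [AddCommGroup G] : Prop :=
  ∀ (H : Type u) [AddCommGroup H] (π : H →+ G),
    Function.Surjective π → Nonempty (π.ker ≃+ ℤ) →
      ∃ s : G →+ H, π.comp s = AddMonoidHom.id G

/-- strongly κ-free -/
def IsStronglyKappaFree (κ : Cardinal.{u}) (G : Type u) [AddCommGroup G] : Prop :=
  IsKappaFree κ G ∧
    ∀ H : AddSubgroup G, Cardinal.mk H < κ →
      ∃ K : AddSubgroup G, H ≤ K ∧ Cardinal.mk K < κ ∧ IsKappaFree κ (G ⧸ K)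

universe v
open Cardinal Set

/-- Submodules of free modules over a principal ideal domain are free: the case of `ι →₀ R`. -/
theorem Submodule.free_of_finsupp {R ι : Type*} [CommRing R] [IsDomain R]
    [IsPrincipalIdealRing R] (N : Submodule R (ι →₀ R)) : Module.Free R N := by
  classical
  obtain ⟨_, _⟩ := exists_wellFoundedLT ι
  let A (i : ι) : Submodule R (ι →₀ R) := N ⊓ Finsupp.supported R R (Iic i)
  have hA {i : ι} {y : ι →₀ R} : y ∈ A i ↔ y ∈ N ∧ ∀ j, i < j → y j = 0 := by
    refine and_congr_right fun _ => (Finsupp.mem_supported' R y).trans ?_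
    simp
  have hgen (i : ι) : ∃ x ∈ A i, ∀ y ∈ A i, ∃ r : R, y i = r * x i := by
    obtain ⟨a, ha⟩ := (IsPrincipalIdealRing.principal ((A i).map (Finsupp.lapply i))).principal
    obtain ⟨x, hx, rfl⟩ : a ∈ (A i).map (Finsupp.lapply i) := by
      rw [ha]; exact Submodule.mem_span_singleton_self a
    refine ⟨x, hx, fun y hy => ?_⟩
    obtain ⟨r, hr⟩ := Submodule.mem_span_singleton.1 (ha ▸ Submodule.mem_map_of_mem hy)
    exact ⟨r, hr.symm⟩
  choose x hxA hx using hgen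
  let v : {i // x i i ≠ 0} → ι →₀ R := fun i => x i
  have hv : LinearIndependent R v := by
    refine linearIndependent_iff.2 fun c hc => ?_
    by_contra hne
    have hs : c.support.Nonempty := Finsupp.support_nonempty_iff.2 hne
    let j := c.support.max' hs
    have hj : c j ≠ 0 := Finsupp.mem_support_iff.1 (c.support.max'_mem hs)
    have h := DFunLike.congr_fun hc j.1
    rw [Finsupp.linearCombination_apply, Finsupp.sum, Finsupp.finsetSum_apply,
      Finset.sum_eq_single j] at h
    · exact mul_ne_zero hj j.2 h
    · intro k hk hkj
      have : k < j := lt_of_le_of_ne (c.support.le_max' k hk) hkj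
      simp [v, (hA.1 (hxA k)).2 j this]
    · intro h'
      exact absurd (c.support.max'_mem hs) h'
  have hmem (y : ι →₀ R) (hy : y ∈ N) (hy0 : y ≠ 0) :
      ∃ i, y i ≠ 0 ∧ y ∈ A i := by
    have hs : y.support.Nonempty := Finsupp.support_nonempty_iff.2 hy0
    refine ⟨y.support.max' hs, Finsupp.mem_support_iff.1 (y.support.max'_mem hs), hA.2 ⟨hy, ?_⟩⟩
    intro j hj
    by_contra h
    exact (y.support.le_max' j (Finsupp.mem_support_iff.2 h)).not_gt hj
  have hspan (i : ι) : A i ≤ Submodule.span R (range v) := by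
    induction i using WellFoundedLT.induction with
    | ind i ih =>
    have hlower {z : ι →₀ R} (hz : z ∈ A i) (hzi : z i = 0) : z ∈ Submodule.span R (range v) := by
      by_cases h0 : z = 0
      · rw [h0]; exact zero_mem _
      obtain ⟨k, hk, hkA⟩ := hmem z (hA.1 hz).1 h0
      refine ih k (lt_of_not_ge fun hik => hk ?_) hkA
      rcases hik.eq_or_lt with rfl | hik
      · exact hzi
      · exact (hA.1 hz).2 k hik
    intro y hy
    obtain ⟨r, hr⟩ := hx i y hy
    by_cases hxi : x i i = 0
    · exact hlower hy (by rw [hr, hxi, mul_zero])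
    · have hrx : r • x i ∈ Submodule.span R (range v) :=
        Submodule.smul_mem _ r (Submodule.subset_span ⟨⟨i, hxi⟩, rfl⟩)
      have hsub := hlower ((A i).sub_mem hy ((A i).smul_mem r (hxA i))) (by simp [hr])
      simpa using add_mem hsub hrx
  have hN : N = Submodule.span R (range v) := by
    refine le_antisymm (fun y hy => ?_) (Submodule.span_le.2 ?_)
    · by_cases h0 : y = 0
      · rw [h0]; exact zero_mem _
      · obtain ⟨i, -, hi⟩ := hmem y hy h0
        exact hspan i hi
    · rintro _ ⟨i, rfl⟩
      exact (hA.1 (hxA i)).1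
  rw [hN]
  exact Module.Free.of_basis (Module.Basis.span hv)

/-- A module that embeds in a free module over a principal ideal domain is free. -/
theorem Module.Free.of_injective {R M N : Type*} [CommRing R] [IsDomain R]
    [IsPrincipalIdealRing R] [AddCommGroup M] [Module R M] [AddCommGroup N] [Module R N]
    [Module.Free R N] (f : M →ₗ[R] N) (hf : Function.Injective f) : Module.Free R M := by
  let g := (Module.Free.chooseBasis R N).repr.toLinearMap ∘ₗ f
  have hg : Function.Injective g := (Module.Free.chooseBasis R N).repr.injective.comp hf
  have := Submodule.free_of_finsupp (LinearMap.range g)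
  exact Module.Free.of_equiv (LinearEquiv.ofInjective g hg).symm

theorem Module.Free.of_ker_of_range {R M N : Type*} [Ring R] [AddCommGroup M] [Module R M]
    [AddCommGroup N] [Module R N] (f : M →ₗ[R] N) [Module.Free R (LinearMap.ker f)]
    [Module.Free R (LinearMap.range f)] : Module.Free R M := by
  obtain ⟨s, hs⟩ := f.rangeRestrict.exists_rightInverse_of_surjective f.range_rangeRestrict
  have hex : Function.Exact (LinearMap.ker f).subtype f.rangeRestrict := by
    rw [LinearMap.exact_iff, LinearMap.ker_rangeRestrict, Submodule.range_subtype]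
  exact Module.Free.of_equiv
    (hex.splitSurjectiveEquiv (LinearMap.ker f).injective_subtype ⟨s, hs⟩).1.symm

section

variable {R : Type*} {M : Type v} [CommRing R] [AddCommGroup M] [Module R M]

theorem Submodule.exists_linearIndependent_span_eq (P : Submodule R M) [Module.Free R P] :
    ∃ (ι : Type v) (v : ι → M), LinearIndependent R v ∧ Submodule.span R (range v) = P := by
  let b := Module.Free.chooseBasis R P
  refine ⟨_, fun i => b i, b.linearIndependent.map' P.subtype P.ker_subtype, ?_⟩
  have h := Submodule.map_span P.subtype (range b)
  rw [b.span_eq, Submodule.map_top, Submodule.range_subtype, ← range_comp] at h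
  exact h.symm

theorem LinearIndependent.free_map_mkQ_span_image {ι : Type*} {v : ι → M}
    (hv : LinearIndependent R v) (S : Set ι) :
    Module.Free R ((Submodule.span R (range v)).map (Submodule.span R (v '' S)).mkQ) := by
  set K := Submodule.span R (v '' S)
  have hli : LinearIndependent R (K.mkQ ∘ fun i : (Sᶜ : Set ι) => v i) := by
    refine (hv.comp _ Subtype.val_injective).map ?_
    rw [Submodule.ker_mkQ, range_comp, Subtype.range_coe]
    exact hv.disjoint_span_image disjoint_compl_left
  have hspan : (Submodule.span R (range v)).map K.mkQ =
      Submodule.span R (range (K.mkQ ∘ fun i : (Sᶜ : Set ι) => v i)) := by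
    rw [Submodule.map_span]
    refine le_antisymm (Submodule.span_le.2 ?_) (Submodule.span_mono ?_)
    · rintro _ ⟨_, ⟨i, rfl⟩, rfl⟩
      by_cases hi : i ∈ S
      · have : K.mkQ (v i) = 0 :=
          (Submodule.Quotient.mk_eq_zero K).2 (Submodule.subset_span ⟨i, hi, rfl⟩)
        rw [this]
        exact zero_mem _
      · exact Submodule.subset_span ⟨⟨i, hi⟩, rfl⟩
    · rintro _ ⟨i, rfl⟩
      exact ⟨v i, ⟨i, rfl⟩, rfl⟩
  rw [hspan]
  exact Module.Free.of_basis (Module.Basis.span hli)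

theorem Submodule.free_map_mkQ_trans [IsDomain R] [IsPrincipalIdealRing R]
    {K N P : Submodule R M} (hKN : K ≤ N) (hN : Module.Free R (N.map K.mkQ))
    (hP : Module.Free R (P.map N.mkQ)) : Module.Free R (P.map K.mkQ) := by
  let f : P.map K.mkQ →ₗ[R] M ⧸ N := Submodule.factor hKN ∘ₗ (P.map K.mkQ).subtype
  have hrange : LinearMap.range f = P.map N.mkQ := by
    rw [LinearMap.range_comp, Submodule.range_subtype, ← Submodule.map_comp]
    rfl
  have hker (x : LinearMap.ker f) : (x : M ⧸ K) ∈ N.map K.mkQ := by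
    obtain ⟨⟨_, y, hy, rfl⟩, hx⟩ := x
    exact ⟨y, (Submodule.Quotient.mk_eq_zero N).1 hx, rfl⟩
  let g : LinearMap.ker f →ₗ[R] N.map K.mkQ :=
    ((P.map K.mkQ).subtype ∘ₗ (LinearMap.ker f).subtype).codRestrict _ hker
  have hg : Function.Injective g := by
    intro x y hxy
    have := congrArg Subtype.val hxy
    exact Subtype.ext (Subtype.ext this)
  have : Module.Free R (LinearMap.ker f) := 
    Module.Free.of_injective (R := R) (M := LinearMap.ker f) (N := N.map K.mkQ) g hg
  have : Module.Free R (LinearMap.range f) := by rwa [hrange]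
  exact Module.Free.of_ker_of_range f

end

variable {G : Type u} [AddCommGroup G]

theorem Submodule.mk_span_int_le {c : Cardinal.{u}} (hc : ℵ₀ ≤ c) {s : Set G} (hs : #s ≤ c) :
    #(Submodule.span ℤ s) ≤ c := by
  have hr : LinearMap.range (Finsupp.linearCombination ℤ ((↑) : s → G)) =
      Submodule.span ℤ s := by
    rw [Finsupp.range_linearCombination, Subtype.range_coe]
  rw [← hr]
  refine (mk_range_le (f := Finsupp.linearCombination ℤ ((↑) : s → G))).trans ?_
  rcases isEmpty_or_nonempty s with h | h
  · exact (le_one_iff_subsingleton.2 inferInstance).trans (one_le_aleph0.trans hc)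
  · simp [hs, hc]

theorem Submodule.mk_iSup_int_le {c : Cardinal.{u}} (hc : ℵ₀ ≤ c) {ι : Type u} (hι : #ι ≤ c)
    {N : ι → Submodule ℤ G} (hN : ∀ i, #(N i) ≤ c) : #(⨆ i, N i : Submodule ℤ G) ≤ c := by
  rw [Submodule.iSup_eq_span]
  refine Submodule.mk_span_int_le hc ((mk_iUnion_le _).trans ?_)
  exact (mul_le_mul' hι (ciSup_le' hN)).trans (mul_eq_self hc).le

theorem Submodule.mk_sup_int_le {c : Cardinal.{u}} (hc : ℵ₀ ≤ c) {N P : Submodule ℤ G}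
    (hN : #N ≤ c) (hP : #P ≤ c) : #(N ⊔ P : Submodule ℤ G) ≤ c := by
  rw [← Submodule.span_eq N, ← Submodule.span_eq P, ← Submodule.span_union]
  exact Submodule.mk_span_int_le hc ((mk_union_le _ _).trans (add_le_of_le hc hN hP))

theorem Submodule.exists_le_span_image {c : Cardinal.{u}} (hc : ℵ₀ ≤ c) {ι : Type u}
    (v : ι → G) {K : Submodule ℤ G} (hK : #K ≤ c) (hKv : K ≤ Submodule.span ℤ (range v)) :
    ∃ S : Set ι, #S ≤ c ∧ K ≤ Submodule.span ℤ (v '' S) := by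
  have h (x : K) : ∃ T : Finset ι, (x : G) ∈ Submodule.span ℤ (v '' T) := by
    have hx := hKv x.2
    rw [← image_univ, Finsupp.mem_span_image_iff_linearCombination] at hx
    obtain ⟨l, -, hl⟩ := hx
    exact ⟨l.support, (Finsupp.mem_span_image_iff_linearCombination ℤ).2
      ⟨l, Finsupp.mem_supported_support ℤ l, hl⟩⟩
  choose T hT using h
  refine ⟨⋃ x, (T x : Set ι), (mk_iUnion_le _).trans ?_, fun x hx => ?_⟩
  · refine (mul_le_mul' hK (ciSup_le' fun x => ?_)).trans (mul_eq_self hc).le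
    exact (lt_aleph0_of_finite _).le.trans hc
  · exact Submodule.span_mono (image_mono (subset_iUnion (fun x => (T x : Set ι)) ⟨x, hx⟩))
      (hT ⟨x, hx⟩)

/-- If `#K ≤ c` and every subgroup of `G ⧸ K` that lifts to a subgroup of cardinality at most `c`
is free, then `P ⧸ K` is free for every free subgroup `P` containing `K`. -/
theorem Submodule.free_map_mkQ_of_forall_mk_le {c : Cardinal.{u}} (hc : ℵ₀ ≤ c)
    {K : Submodule ℤ G} (hK : #K ≤ c)
    (hfree : ∀ L : Submodule ℤ G, #L ≤ c → Module.Free ℤ (L.map K.mkQ))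
    {P : Submodule ℤ G} (hKP : K ≤ P) [Module.Free ℤ P] : Module.Free ℤ (P.map K.mkQ) := by
  obtain ⟨ι, v, hv, hvP⟩ := P.exists_linearIndependent_span_eq
  obtain ⟨S, hS, hKS⟩ := Submodule.exists_le_span_image hc v hK (hKP.trans hvP.ge)
  refine Submodule.free_map_mkQ_trans hKS
    (hfree _ (Submodule.mk_span_int_le hc (mk_image_le.trans hS))) ?_
  rw [← hvP]
  exact hv.free_map_mkQ_span_image S

/-- A regular well-order of cardinality `c⁺`. -/
theorem exists_wellOrder_succ {c : Cardinal.{u}} (hc : ℵ₀ ≤ c) :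
    ∃ (I : Type u) (_ : LinearOrder I) (_ : WellFoundedLT I), #I = Order.succ c ∧
      (∀ a : I, #(Iio a) ≤ c) ∧ ∀ S : Set I, #S ≤ c → ∃ a, ∀ s ∈ S, s < a := by
  refine ⟨(Order.succ c).ord.ToType, inferInstance, inferInstance, mk_ord_toType _,
    fun a => Order.lt_succ_iff.1 (by simpa using mk_Iio_lt a (by simp)), fun S hS => ?_⟩
  by_contra! h
  have hle := Order.cof_le (s := S) fun a => h a
  rw [Ordinal.cof_toType, (isRegular_succ hc).cof_ord] at hle
  exact (Order.lt_succ c).not_ge (hle.trans hS)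

/-- If all subgroups of cardinality at most `c⁺` are free, then every subgroup of cardinality at
most `c` lies in a subgroup `K` of cardinality at most `c` such that `G ⧸ K` is `c⁺`-free. Otherwise
a continuous chain of length `c⁺` with non-free successive quotients has a non-free union. -/
theorem exists_le_forall_free_map_mkQ {c : Cardinal.{u}} (hc : ℵ₀ ≤ c)
    (hG : ∀ M : Submodule ℤ G, #M ≤ Order.succ c → Module.Free ℤ M)
    {H : Submodule ℤ G} (hH : #H ≤ c) :
    ∃ K : Submodule ℤ G, H ≤ K ∧ #K ≤ c ∧
      ∀ L : Submodule ℤ G, #L ≤ c → Module.Free ℤ (L.map K.mkQ) := by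
  by_contra! hbad
  have hstep (K : Submodule ℤ G) : ∃ L, K ≤ L ∧ (#K ≤ c → #L ≤ c) ∧
      (H ≤ K → #K ≤ c → ¬ Module.Free ℤ (L.map K.mkQ)) := by
    by_cases h : H ≤ K ∧ #K ≤ c
    · obtain ⟨L, hL, hLK⟩ := hbad K h.1 h.2
      refine ⟨K ⊔ L, le_sup_left, fun hK => Submodule.mk_sup_int_le hc hK hL, fun _ _ => ?_⟩
      rwa [Submodule.map_sup, Submodule.mkQ_map_self, bot_sup_eq]
    · exact ⟨K, le_rfl, id, fun h1 h2 => absurd ⟨h1, h2⟩ h⟩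
  choose next hle_next hnext_card hnext_bad using hstep
  obtain ⟨I, _, _, hI, hseg, hbdd⟩ := exists_wellOrder_succ hc
  let K : I → Submodule ℤ G := WellFoundedLT.fix fun a ih => H ⊔ ⨆ b : Iio a, next (ih b b.2)
  have hK (a : I) : K a = H ⊔ ⨆ b : Iio a, next (K b) := WellFoundedLT.fix_eq _ a
  have hHK (a : I) : H ≤ K a := (hK a).symm ▸ le_sup_left
  have hnextK {a b : I} (hab : a < b) : next (K a) ≤ K b := by
    rw [hK b]
    exact (le_iSup (fun b : Iio b => next (K b)) ⟨a, hab⟩).trans le_sup_right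
  have hKcard (a : I) : #(K a) ≤ c := by
    induction a using WellFoundedLT.induction with
    | ind a ih =>
    rw [hK a]
    exact Submodule.mk_sup_int_le hc hH
      (Submodule.mk_iSup_int_le hc (hseg a) fun b => hnext_card _ (ih b b.2))
  let M := ⨆ a, next (K a)
  have hKM (a : I) : K a ≤ M := (hle_next _).trans (le_iSup (fun a => next (K a)) a)
  have hMcard : #M ≤ Order.succ c :=
    Submodule.mk_iSup_int_le (hc.trans (Order.le_succ c)) hI.le
      fun a => (hnext_card _ (hKcard a)).trans (Order.le_succ c)
  have := hG M hMcard
  obtain ⟨ι, v, hv, hvM⟩ := M.exists_linearIndependent_span_eq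
  have hmono : Monotone K := monotone_iff_forall_lt.2 fun a b hab => (hle_next _).trans (hnextK hab)
  have hclose (a : I) : ∃ b, a < b ∧ ∃ S, K a ≤ Submodule.span ℤ (v '' S) ∧
      Submodule.span ℤ (v '' S) ≤ K b := by
    obtain ⟨S, hS, hKS⟩ :=
      Submodule.exists_le_span_image hc v (hKcard a) ((hKM a).trans hvM.ge)
    have hmem (i : S) : ∃ b, v i ∈ K b := by
      have hi : v i ∈ M := hvM.le (Submodule.subset_span (mem_range_self _))
      have : Nonempty I := ⟨a⟩
      have hdir : Directed (· ≤ ·) fun a => next (K a) :=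
        Monotone.directed_le (monotone_iff_forall_lt.2 fun a b hab =>
          (hnextK hab).trans (hle_next _))
      obtain ⟨b, hb⟩ := (Submodule.mem_iSup_of_directed _ hdir).1 hi
      obtain ⟨d, hd⟩ := hbdd {b} ((mk_singleton b).le.trans (one_le_aleph0.trans hc))
      exact ⟨d, hnextK (hd b rfl) hb⟩
    choose f hf using hmem
    obtain ⟨b, hb⟩ := hbdd (insert a (range f))
      ((mk_insert_le).trans (add_le_of_le hc (mk_range_le.trans hS) (one_le_aleph0.trans hc)))
    refine ⟨b, hb a (mem_insert _ _), S, hKS, Submodule.span_le.2 ?_⟩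
    rintro _ ⟨i, hi, rfl⟩
    exact hmono (hb _ (mem_insert_of_mem _ ⟨⟨i, hi⟩, rfl⟩)).le (hf ⟨i, hi⟩)
  choose g hag S hKS hSK using hclose
  obtain ⟨a₀, -⟩ := hbdd ∅ (by simp)
  let s : ℕ → I := fun n => g^[n] a₀
  have hs (n : ℕ) : s (n + 1) = g (s n) := Function.iterate_succ_apply' g n a₀
  obtain ⟨a, ha⟩ : ∃ a, IsLUB (range s) a := by
    obtain ⟨b, hb⟩ := hbdd (range s) ((countable_range s).le_aleph0.trans hc)
    let U := upperBounds (range s)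
    have hU : U.Nonempty := ⟨b, fun x hx => (hb x hx).le⟩
    exact ⟨wellFounded_lt.min U hU, wellFounded_lt.min_mem U hU,
      fun x hx => wellFounded_lt.min_le hx⟩
  have hsa (n : ℕ) : s n < a :=
    ((hag _).trans_eq (hs n).symm).trans_le (ha.1 (mem_range_self (n + 1)))
  have hKa : K a = Submodule.span ℤ (v '' ⋃ n, S (s n)) := by
    refine le_antisymm ?_ ?_
    · have hn (n : ℕ) : K (s n) ≤ Submodule.span ℤ (v '' ⋃ n, S (s n)) :=
        (hKS _).trans (Submodule.span_mono (image_mono (subset_iUnion (fun n => S (s n)) n)))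
      rw [hK a]
      refine sup_le ((hHK (s 0)).trans (hn 0)) (iSup_le fun b => ?_)
      obtain ⟨_, ⟨n, rfl⟩, hbn⟩ := (lt_isLUB_iff ha).1 b.2
      exact (hnextK hbn).trans (hn n)
    · rw [image_iUnion, Submodule.span_iUnion]
      exact iSup_le fun n => (hSK _).trans (hmono ((hs n).ge.trans (hsa (n + 1)).le))
  refine hnext_bad (K a) (hHK a) (hKcard a) ?_
  have hfree : Module.Free ℤ (M.map (K a).mkQ) := by
    rw [hKa, ← hvM]
    exact hv.free_map_mkQ_span_image _
  exact Module.Free.of_injective _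
    (Submodule.inclusion_injective (Submodule.map_mono (le_iSup (fun a => next (K a)) a)))

theorem AddSubgroup.mk_comap_mk'_le (K : AddSubgroup G) (Q : AddSubgroup (G ⧸ K)) :
    #(Q.comap (QuotientAddGroup.mk' K)) = #K * #Q :=
  (mk_congr (QuotientAddGroup.preimageMkEquivAddSubgroupProdSet K (Q : Set (G ⧸ K)))).trans
    (mk_prod _ _) |>.trans (by simp)

theorem stmt5 (κ : Cardinal.{u}) (hlimit : ∀ μ : Cardinal.{u}, κ ≠ Order.succ μ)
    (G : Type u) [AddCommGroup G] (hcard : Cardinal.mk G = κ)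
    (hfree : IsKappaFree κ G) :
    IsStronglyKappaFree κ G := by
  have hκ : ℵ₀ ≤ κ := by
    by_contra! h
    obtain ⟨n, rfl⟩ := lt_aleph0.1 h
    cases n with
    | zero => exact mk_ne_zero G (hcard.trans Nat.cast_zero)
    | succ n => exact hlimit n (by rw [Nat.cast_succ, ← succ_natCast])
  refine ⟨hfree, fun H hH => ?_⟩
  have hcomap {K : AddSubgroup G} (hK : #K < κ) {Q : AddSubgroup (G ⧸ K)} (hQ : #Q < κ) :
      #(Q.comap (QuotientAddGroup.mk' K)) < κ := by
    rw [AddSubgroup.mk_comap_mk'_le]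
    exact mul_lt_of_lt hκ hK hQ
  rcases hκ.eq_or_lt with rfl | hκ
  · refine ⟨H, le_rfl, hH, fun Q hQ => ?_⟩
    have hP := hcomap hH hQ
    have : Finite (Q.comap (QuotientAddGroup.mk' H)) := lt_aleph0_iff_finite.1 hP
    have hPfree : Module.Free ℤ (Q.comap (QuotientAddGroup.mk' H)) := hfree _ hP
    have hPsub : Subsingleton (Q.comap (QuotientAddGroup.mk' H)) := by
      by_contra h
      rw [not_subsingleton_iff_nontrivial] at h
      exact not_finite_iff_infinite.2 (Module.Free.infinite ℤ _) this
    have : Subsingleton Q := by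
      refine ⟨fun x y => Subtype.ext ?_⟩
      obtain ⟨x', hx⟩ := QuotientAddGroup.mk'_surjective H x
      obtain ⟨y', hy⟩ := QuotientAddGroup.mk'_surjective H y
      have hxy : x' = y' := congrArg Subtype.val (hPsub.elim ⟨x', by simp [hx]⟩ ⟨y', by simp [hy]⟩)
      rw [← hx, ← hy, hxy]
    exact Module.Free.of_subsingleton ℤ Q
  · have hc : max #H ℵ₀ < κ := max_lt hH hκ
    have hsucc : Order.succ (max #H ℵ₀) < κ :=
      lt_of_le_of_ne (Order.succ_le_of_lt hc) (hlimit _).symm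
    have hG (M : Submodule ℤ G) (hM : #M < κ) : Module.Free ℤ M := hfree M.toAddSubgroup hM
    obtain ⟨K, hHK, hK, hKfree⟩ := exists_le_forall_free_map_mkQ (G := G) (le_max_right #H ℵ₀)
      (fun M hM => hG M (hM.trans_lt hsucc)) (H := AddSubgroup.toIntSubmodule H)
      (le_max_left #H ℵ₀)
    refine ⟨K.toAddSubgroup, hHK, hK.trans_lt hc, fun Q hQ => ?_⟩
    let P := AddSubgroup.toIntSubmodule (Q.comap (QuotientAddGroup.mk' K.toAddSubgroup))
    have hP : Module.Free ℤ P := hG P (hcomap (hK.trans_lt hc) hQ)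
    have hKP : K ≤ P := fun x hx => by
      have : QuotientAddGroup.mk' K.toAddSubgroup x = 0 := (QuotientAddGroup.eq_zero_iff x).2 hx
      change QuotientAddGroup.mk' K.toAddSubgroup x ∈ Q
      rw [this]; exact zero_mem _
    have hPK := Submodule.free_map_mkQ_of_forall_mk_le (le_max_right #H ℵ₀) hK hKfree hKP
    let f : Q →+ G ⧸ K := Q.subtype
    have hmem (y : Q) : f y ∈ P.map K.mkQ := by
      obtain ⟨x, hx⟩ := QuotientAddGroup.mk'_surjective K.toAddSubgroup y
      have hxQ : QuotientAddGroup.mk' K.toAddSubgroup x ∈ Q := by rw [hx]; exact y.2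
      exact ⟨x, hxQ, hx⟩
    have hf : Function.Injective (f.toIntLinearMap.codRestrict _ hmem) :=
      (LinearMap.injective_codRestrict_iff _).2 Subtype.val_injective
    exact Module.Free.of_injective _ hf
end

section
/- (Stein) Every countable Whitehead abelian group is free. -/
universe u

open Submodule

section Chain

variable {R M : Type*} [CommRing R] [AddCommGroup M] [Module R M]

/-- If every successive complement in a chain of submodules starting at `⊥` is `C n`, then the
`C n` are independent. -/
lemma iSupIndep_of_chain {P C : ℕ → Submodule R M} (hmono : Monotone P)
    (hC : ∀ n, C n ≤ P (n + 1)) (hdisj : ∀ n, Disjoint (P n) (C n)) : iSupIndep C := by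
  classical
  refine iSupIndep_of_dfinsupp_lsum_injective C ?_
  rw [injective_iff_map_eq_zero]
  intro f hf
  by_contra hne
  have hs : f.support.Nonempty := by
    rwa [Finset.nonempty_iff_ne_empty, Ne, DFinsupp.support_eq_empty]
  set m := f.support.max' hs with hm
  have hmem : m ∈ f.support := Finset.max'_mem _ _
  have hsum : ∑ i ∈ f.support, (f i : M) = 0 := by
    simpa [DFinsupp.lsum_apply_apply, DFinsupp.sumAddHom_apply, DFinsupp.sum] using hf
  rw [← Finset.add_sum_erase _ _ hmem] at hsum
  have hP : (f m : M) ∈ P m := by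
    rw [eq_neg_of_add_eq_zero_left hsum]
    refine neg_mem (sum_mem fun i hi ↦ ?_)
    have hlt : i < m := lt_of_le_of_ne (Finset.le_max' _ _ (Finset.mem_of_mem_erase hi))
      (Finset.ne_of_mem_erase hi)
    exact hmono hlt (hC i (f i).2)
  have h0 : (f m : M) = 0 := disjoint_def.1 (hdisj m) _ hP (f m).2
  exact (DFinsupp.mem_support_iff.1 hmem) (Subtype.ext h0)

/-- A module which is the union of a chain of submodules, each having a free complement in the
next one, is free. -/
lemma Module.Free.of_chain {P C : ℕ → Submodule R M} (h0 : P 0 = ⊥)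
    (hsup : ∀ n, P n ⊔ C n = P (n + 1)) (hdisj : ∀ n, Disjoint (P n) (C n))
    (hfree : ∀ n, Module.Free R (C n)) (htop : ⨆ n, P n = ⊤) : Module.Free R M := by
  classical
  have hmono : Monotone P := monotone_nat_of_le_succ fun n ↦ hsup n ▸ le_sup_left
  have hind : iSupIndep C := iSupIndep_of_chain hmono (fun n ↦ hsup n ▸ le_sup_right) hdisj
  have hle (n : ℕ) : P n ≤ ⨆ i, C i := by
    induction n with
    | zero => simp [h0]
    | succ n ih => exact hsup n ▸ sup_le ih (le_iSup C n)
  have hint : DirectSum.IsInternal C :=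
    DirectSum.isInternal_submodule_of_iSupIndep_of_iSup_eq_top hind
      (top_le_iff.1 (htop ▸ iSup_le hle))
  exact Module.Free.of_basis (hint.collectedBasis fun n ↦ Module.Free.chooseBasis R (C n))

/-- A submodule `N` with torsion-free quotient has a free complement in every larger
finitely generated submodule. -/
lemma Submodule.exists_free_complement [IsDomain R] [IsPrincipalIdealRing R]
    {N L : Submodule R M} (hNL : N ≤ L) (hL : L.FG) [Module.IsTorsionFree R (M ⧸ N)] :
    ∃ C : Submodule R M, Module.Free R C ∧ N ⊔ C = L ∧ Disjoint N C := by
  have : Module.Finite R (L.map N.mkQ) := Module.Finite.iff_fg.2 (hL.map _)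
  have : Module.Free R (L.map N.mkQ) := inferInstance
  obtain ⟨s, hs⟩ := Module.projective_lifting_property (N.mkQ.submoduleMap L) LinearMap.id
    (N.mkQ.submoduleMap_surjective L)
  have hs' (q : L.map N.mkQ) : N.mkQ (s q : M) = q :=
    congrArg Subtype.val (LinearMap.congr_fun hs q)
  have hinj : Function.Injective (L.subtype ∘ₗ s) := by
    intro a b hab
    apply Subtype.ext
    rw [← hs' a, ← hs' b]
    exact congrArg N.mkQ hab
  refine ⟨LinearMap.range (L.subtype ∘ₗ s),
    Module.Free.of_equiv (LinearEquiv.ofInjective _ hinj), le_antisymm ?_ ?_, ?_⟩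
  · refine sup_le hNL ?_
    rintro _ ⟨q, rfl⟩
    exact (s q).2
  · intro x hx
    set q : L.map N.mkQ := ⟨N.mkQ x, mem_map_of_mem hx⟩
    have hN : x - s q ∈ N := by
      rw [← Submodule.Quotient.mk_eq_zero, ← mkQ_apply, map_sub, hs', sub_self]
    exact mem_sup.2 ⟨_, hN, s q, ⟨q, rfl⟩, sub_add_cancel _ _⟩
  · rw [disjoint_def]
    rintro _ hx ⟨q, rfl⟩
    have h0 : (q : M ⧸ N) = 0 := by
      rw [← hs' q]
      exact (Submodule.Quotient.mk_eq_zero N).2 hx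
    rw [show q = 0 from Subtype.ext h0, map_zero]

end Chain

section PureClosure

variable {G : Type*} [AddCommGroup G]

/-- The smallest pure subgroup containing `N`, when the ambient group is torsion-free. -/
def pureClosure (N : Submodule ℤ G) : Submodule ℤ G :=
  (torsion ℤ (G ⧸ N)).comap N.mkQ

lemma mem_pureClosure {N : Submodule ℤ G} {x : G} :
    x ∈ pureClosure N ↔ ∃ n : ℤ, n ≠ 0 ∧ n • x ∈ N := by
  simp only [pureClosure, mem_comap, mem_torsion_iff, Subtype.exists,
    mem_nonZeroDivisors_iff_ne_zero, Submonoid.mk_smul, mkQ_apply, exists_prop,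
    ← Submodule.Quotient.mk_smul, Submodule.Quotient.mk_eq_zero]

lemma le_pureClosure (N : Submodule ℤ G) : N ≤ pureClosure N :=
  fun x hx ↦ mem_pureClosure.2 ⟨1, one_ne_zero, by simpa using hx⟩

lemma pureClosure_mono : Monotone (pureClosure (G := G)) := fun _ _ h _ hx ↦
  let ⟨n, hn, hnx⟩ := mem_pureClosure.1 hx
  mem_pureClosure.2 ⟨n, hn, h hnx⟩

instance (N : Submodule ℤ G) : Module.IsTorsionFree ℤ (G ⧸ pureClosure N) := by
  rw [isTorsionFree_iff_torsion_eq_bot, eq_bot_iff]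
  intro q hq
  obtain ⟨x, rfl⟩ := mkQ_surjective _ q
  obtain ⟨⟨n, hn⟩, hnx⟩ := (mem_torsion_iff _).1 hq
  rw [Submonoid.mk_smul, ← map_smul, mkQ_apply, Submodule.Quotient.mk_eq_zero] at hnx
  obtain ⟨m, hm, hmx⟩ := mem_pureClosure.1 hnx
  rw [mem_bot, mkQ_apply, Submodule.Quotient.mk_eq_zero]
  exact mem_pureClosure.2
    ⟨m * n, mul_ne_zero hm (nonZeroDivisors.ne_zero hn), by rwa [mul_smul]⟩

/-- Pontryagin's criterion for the freeness of a countable group. -/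
lemma Module.Free.of_fg_pureClosure [Countable G] (hbot : pureClosure (⊥ : Submodule ℤ G) = ⊥)
    (hfg : ∀ N : Submodule ℤ G, N.FG → (pureClosure N).FG) : Module.Free ℤ G := by
  obtain ⟨e, he⟩ := exists_surjective_nat G
  let F (n : ℕ) : Submodule ℤ G := span ℤ (e '' Set.Iio n)
  have hF : Monotone F := fun m n h ↦ span_mono (Set.image_mono (Set.Iio_subset_Iio h))
  have hP (n : ℕ) : (pureClosure (F n)).FG :=
    hfg _ (fg_span ((Set.finite_Iio n).image e))
  choose C hfree hsup hdisj using fun n ↦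
    exists_free_complement (pureClosure_mono (hF n.le_succ)) (hP (n + 1))
  refine Module.Free.of_chain (P := fun n ↦ pureClosure (F n)) ?_ hsup hdisj hfree ?_
  · simpa [F] using hbot
  · refine eq_top_iff.2 fun x _ ↦ ?_
    obtain ⟨n, rfl⟩ := he x
    exact mem_iSup_of_mem (n + 1) (le_pureClosure _ (subset_span ⟨n, n.lt_succ_self, rfl⟩))

end PureClosure

section Characters

variable {A : Type*} [AddCommGroup A]

lemma CharacterModule.exists_vanishing_ne_zero {N : Submodule ℤ A} {a : A} (ha : a ∉ N) :
    ∃ η : CharacterModule A, (∀ x ∈ N, η x = 0) ∧ η a ≠ 0 := by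
  obtain ⟨c, hc⟩ := exists_character_apply_ne_zero_of_ne_zero
    (a := N.mkQ a) (by simpa [Submodule.Quotient.mk_eq_zero] using ha)
  refine ⟨dual N.mkQ c, fun x hx ↦ ?_, hc⟩
  rw [dual_apply]
  change c (N.mkQ x) = 0
  rw [mkQ_apply, (Submodule.Quotient.mk_eq_zero N).2 hx, map_zero]

/-- One diagonalisation step: a character can be changed outside a finitely generated subgroup so
as to differ from a given one on a larger finitely generated subgroup. -/
lemma CharacterModule.exists_diagonal_step (hA : ¬ (⊤ : Submodule ℤ A).FG) (χ : CharacterModule A)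
    (e : A) {N : Submodule ℤ A} (hN : N.FG) (θ : CharacterModule A) :
    ∃ (N' : Submodule ℤ A) (θ' : CharacterModule A), N'.FG ∧ N ≤ N' ∧ e ∈ N' ∧
      (∀ x ∈ N, θ' x = θ x) ∧ ∃ a ∈ N', θ' a ≠ χ a := by
  obtain ⟨a, ha⟩ : ∃ a, a ∉ N := by
    by_contra! h
    rw [eq_top_iff'.2 h] at hN
    exact hA hN
  obtain ⟨η, hη, hηa⟩ := exists_vanishing_ne_zero ha
  have hN' : (N ⊔ span ℤ {a, e}).FG := hN.sup (fg_span (by simp))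
  have hmem : ∀ y ∈ ({a, e} : Set A), y ∈ N ⊔ span ℤ {a, e} :=
    fun y hy ↦ mem_sup_right (subset_span hy)
  by_cases h : θ a = χ a
  · refine ⟨_, θ + η, hN', le_sup_left, hmem e (by simp), fun x hx ↦ ?_, a, hmem a (by simp), ?_⟩
    · change θ x + η x = θ x
      rw [hη x hx, add_zero]
    · change θ a + η a ≠ χ a
      rwa [h, Ne, add_eq_left]
  · exact ⟨_, θ, hN', le_sup_left, hmem e (by simp), fun _ _ ↦ rfl, a, hmem a (by simp), h⟩

/-- A countable abelian group with countably many characters is finitely generated. -/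
lemma CharacterModule.fg_of_countable [Countable A] [Countable (CharacterModule A)] :
    (⊤ : Submodule ℤ A).FG := by
  by_contra hA
  obtain ⟨e, he⟩ := exists_surjective_nat A
  obtain ⟨χ, hχ⟩ := exists_surjective_nat (CharacterModule A)
  choose! N' θ' hfg hle hmem hagree hdiff using
    fun (n : ℕ) (N : Submodule ℤ A) (hN : N.FG) (θ : CharacterModule A) ↦
      exists_diagonal_step hA (χ n) (e n) hN θ
  let step (n : ℕ) (s : {N : Submodule ℤ A // N.FG} × CharacterModule A) :
      {N : Submodule ℤ A // N.FG} × CharacterModule A :=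
    (⟨N' n s.1 s.2, hfg n s.1 s.1.2 s.2⟩, θ' n s.1 s.2)
  let s (n : ℕ) : {N : Submodule ℤ A // N.FG} × CharacterModule A :=
    Nat.rec (⟨⊥, fg_bot⟩, 0) step n
  let N (n : ℕ) : Submodule ℤ A := (s n).1
  let θ (n : ℕ) : CharacterModule A := (s n).2
  have hN : Monotone N := monotone_nat_of_le_succ fun n ↦ hle n _ (s n).1.2 _
  have hθ {m n : ℕ} (hmn : m ≤ n) {x : A} (hx : x ∈ N m) : θ n x = θ m x := by
    induction n, hmn using Nat.le_induction with
    | base => rfl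
    | succ n hmn ih => exact (hagree n _ (s n).1.2 _ x (hN hmn hx)).trans ih
  have hcov (x : A) : ∃ n, x ∈ N n := by
    obtain ⟨n, rfl⟩ := he x
    exact ⟨n + 1, hmem n _ (s n).1.2 _⟩
  choose k hk using hcov
  have hlim {n : ℕ} {x : A} (hx : x ∈ N n) : θ (k x) x = θ n x := by
    rcases le_total (k x) n with h | h
    · exact (hθ h (hk x)).symm
    · exact hθ h hx
  let φ : A →+ AddCircle (1 : ℚ) := AddMonoidHom.mk' (fun x ↦ θ (k x) x) fun x y ↦ by
    have hx : x ∈ N (k x ⊔ k y) := hN le_sup_left (hk x)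
    have hy : y ∈ N (k x ⊔ k y) := hN le_sup_right (hk y)
    rw [hlim hx, hlim hy, hlim (add_mem hx hy), map_add]
  obtain ⟨n, hn⟩ := hχ φ
  obtain ⟨a, ha, hne⟩ := hdiff n _ (s n).1.2 (s n).2
  apply hne
  rw [hn]
  exact (hlim (n := n + 1) ha).symm

end Characters

namespace IsWhitehead

variable {G : Type u} [AddCommGroup G]

/-- Characters of a Whitehead group lift along `ℚ → ℚ ⧸ ℤ`. -/
lemma exists_lift (hW : IsWhitehead G) (φ : G →+ AddCircle (1 : ℚ)) :
    ∃ ψ : G →+ ℚ, ∀ x, (ψ x : AddCircle (1 : ℚ)) = φ x := by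
  let δ : G × ℚ →+ AddCircle (1 : ℚ) := φ.comp (AddMonoidHom.fst G ℚ) -
    (QuotientAddGroup.mk' (AddSubgroup.zmultiples (1 : ℚ))).comp (AddMonoidHom.snd G ℚ)
  have hδ (p : G × ℚ) : p ∈ δ.ker ↔ (p.2 : AddCircle (1 : ℚ)) = φ p.1 := by
    rw [AddMonoidHom.mem_ker, eq_comm (b := φ p.1)]
    exact sub_eq_zero
  let π : δ.ker →+ G := (AddMonoidHom.fst G ℚ).comp δ.ker.subtype
  have hπ : Function.Surjective π := fun x ↦ by
    obtain ⟨q, hq⟩ := QuotientAddGroup.mk_surjective (φ x)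
    exact ⟨⟨(x, q), (hδ _).2 hq⟩, rfl⟩
  let ι : ℤ →+ π.ker := AddMonoidHom.mk'
    (fun n ↦ ⟨⟨(0, (n : ℚ)), (hδ _).2 (by
      rw [map_zero, AddCircle.coe_eq_zero_iff]
      exact ⟨n, by simp⟩)⟩, rfl⟩)
    fun m n ↦ by ext <;> simp
  have hι : Function.Bijective ι := by
    refine ⟨fun m n h ↦ ?_, ?_⟩
    · have h' : (m : ℚ) = n := congrArg (fun z ↦ z.1.1.2) h
      exact_mod_cast h'
    · rintro ⟨⟨⟨x, q⟩, hp⟩, hx⟩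
      obtain rfl : x = 0 := hx
      have hq := (hδ _).1 hp
      rw [map_zero, AddCircle.coe_eq_zero_iff] at hq
      obtain ⟨n, hn⟩ := hq
      exact ⟨n, Subtype.ext (Subtype.ext (Prod.ext rfl (by simpa using hn : (n : ℚ) = q)))⟩
  obtain ⟨s, hs⟩ := hW δ.ker π hπ ⟨(AddEquiv.ofBijective ι hι).symm⟩
  refine ⟨(AddMonoidHom.snd G ℚ).comp (δ.ker.subtype.comp s), fun x ↦ ?_⟩
  have hx : (s x : G × ℚ).1 = x := DFunLike.congr_fun hs x
  have h := (hδ _).1 (s x).2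
  rwa [hx] at h

lemma pureClosure_bot (hW : IsWhitehead G) : pureClosure (⊥ : Submodule ℤ G) = ⊥ := by
  refine eq_bot_iff.2 fun x hx ↦ (mem_bot ℤ).2 ?_
  obtain ⟨n, hn, hnx⟩ := mem_pureClosure.1 hx
  refine CharacterModule.eq_zero_of_character_apply fun c ↦ ?_
  obtain ⟨ψ, hψ⟩ := hW.exists_lift c
  have h0 : n • ψ x = 0 := by rw [← map_zsmul, (mem_bot ℤ).1 hnx, map_zero]
  have hx0 : ψ x = 0 := (smul_eq_zero.1 h0).resolve_left hn
  exact (hψ x).symm.trans (by rw [hx0]; rfl)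

lemma countable_characterModule_torsion (hW : IsWhitehead G) {N : Submodule ℤ G} (hN : N.FG) :
    Countable (CharacterModule (torsion ℤ (G ⧸ N))) := by
  obtain ⟨S, hS⟩ := hN
  have hlift (χ : CharacterModule (torsion ℤ (G ⧸ N))) :
      ∃ ψ : G →+ ℚ, ∀ (x : G) (hx : N.mkQ x ∈ torsion ℤ (G ⧸ N)),
        (ψ x : AddCircle (1 : ℚ)) = χ ⟨N.mkQ x, hx⟩ := by
    obtain ⟨c, rfl⟩ := CharacterModule.dual_surjective_of_injective
      (torsion ℤ (G ⧸ N)).subtype (injective_subtype _) χ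
    obtain ⟨ψ, hψ⟩ := hW.exists_lift (CharacterModule.dual N.mkQ c)
    exact ⟨ψ, fun x _ ↦ hψ x⟩
  choose ψ hψ using hlift
  refine Function.Injective.countable (β := S → ℚ) (f := fun χ y ↦ ψ χ y) fun χ₁ χ₂ h ↦ ?_
  have hN' : ∀ x ∈ N, ψ χ₁ x = ψ χ₂ x := by
    intro x hx
    rw [← hS] at hx
    exact LinearMap.eqOn_span (f := (ψ χ₁).toIntLinearMap) (g := (ψ χ₂).toIntLinearMap)
      (fun y hy ↦ congrFun h ⟨y, hy⟩) hx
  refine CharacterModule.ext _ fun ⟨q, hq⟩ ↦ ?_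
  obtain ⟨x, rfl⟩ := mkQ_surjective _ q
  obtain ⟨n, hn, hnx⟩ := mem_pureClosure.1 (show x ∈ pureClosure N from hq)
  have hx : ψ χ₁ x = ψ χ₂ x := by
    have := hN' _ hnx
    rw [map_zsmul, map_zsmul] at this
    exact smul_right_injective ℚ hn this
  rw [← hψ χ₁ x hq, ← hψ χ₂ x hq, hx]

lemma fg_pureClosure [Countable G] (hW : IsWhitehead G) {N : Submodule ℤ G} (hN : N.FG) :
    (pureClosure N).FG := by
  have := hW.countable_characterModule_torsion hN
  have : Countable (G ⧸ N) := (mkQ_surjective N).countable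
  have hT : (torsion ℤ (G ⧸ N)).FG := Module.Finite.iff_fg.1 ⟨CharacterModule.fg_of_countable⟩
  refine fg_of_fg_map_of_fg_inf_ker N.mkQ ?_ ?_
  · rwa [pureClosure, map_comap_eq_of_surjective (mkQ_surjective N)]
  · rwa [ker_mkQ, inf_eq_right.2 (le_pureClosure N)]

end IsWhitehead

/-- Stein: every countable Whitehead group is free. -/
theorem stmt9 (G : Type u) [AddCommGroup G]
    (hcount : Cardinal.mk G ≤ Cardinal.aleph0) (hW : IsWhitehead G) :
    IsFreeAbelian G := by
  have : Countable G := Cardinal.mk_le_aleph0_iff.1 hcount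
  exact Module.Free.of_fg_pureClosure hW.pureClosure_bot fun _ hN ↦ hW.fg_pureClosure hN
end
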